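/- Let a < m be real numbers. There exists ε > 0, depending only on n, a, m and on the ellipticity function λ(·) of (H1) and the bound function L(·) of the rescaled condition, with the following property: if u is a Lipschitz solution of the boundary (Signorini) obstacle problem in B₁⁺ with F, F₀ satisfying (H0), (H1) and (F, F₀) being ε-rescaled, such that (i) u(x) ≤ a·x_{n+1} + ε for all x ∈ B₁⁺, and (ii) for every x ∈ B₁' ∖ Λ(u) the one-sided normal derivative ∂_{n+1}u(x) := lim_{t→0⁺} (u(x + t·e_{n+1}) − u(x))/t exists and satisfies ∂_{n+1}u(x) > m, then B'_{1/2} ⊂ Λ(u). -/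

import Mathlib

open MeasureTheory Metric Filter
open scoped InnerProductSpace NNReal ENNReal Topology

noncomputable section

/-- Euclidean space `ℝ^{n+1}`. -/
abbrev Eucl (n : ℕ) : Type := EuclideanSpace ℝ (Fin (n + 1))

namespace TOP

variable {n : ℕ}

/-- The `(n+1)`-st standard basis vector `e_{n+1}`. -/
def eLast (n : ℕ) : Eucl n := EuclideanSpace.single (Fin.last n) 1

/-- Open upper half ball `B_r⁺(x₀)`. -/
def hBall (x₀ : Eucl n) (r : ℝ) : Set (Eucl n) :=
  Metric.ball x₀ r ∩ {x : Eucl n | 0 < x (Fin.last n)}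

/-- Open lower half ball `B_r⁻(x₀)`. -/
def hBallNeg (x₀ : Eucl n) (r : ℝ) : Set (Eucl n) :=
  Metric.ball x₀ r ∩ {x : Eucl n | x (Fin.last n) < 0}

/-- Thin ball `B_r'(x₀)`. -/
def tBall (x₀ : Eucl n) (r : ℝ) : Set (Eucl n) :=
  Metric.ball x₀ r ∩ {x : Eucl n | x (Fin.last n) = 0}

/-- (H0): `F` and `F₀` are of class `C¹` on `B₁ × ℝ × ℝ^{n+1}`. -/
def H0 (F : Eucl n → ℝ → Eucl n → Eucl n) (F₀ : Eucl n → ℝ → Eucl n → ℝ) : Prop :=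
  ContDiffOn ℝ 1 (fun q : Eucl n × ℝ × Eucl n => F q.1 q.2.1 q.2.2)
      (Metric.ball (0 : Eucl n) 1 ×ˢ (Set.univ : Set ℝ) ×ˢ (Set.univ : Set (Eucl n))) ∧
    ContDiffOn ℝ 1 (fun q : Eucl n × ℝ × Eucl n => F₀ q.1 q.2.1 q.2.2)
      (Metric.ball (0 : Eucl n) 1 ×ˢ (Set.univ : Set ℝ) ×ˢ (Set.univ : Set (Eucl n)))

/-- (H1): uniform ellipticity of `D_pF` on compact subsets. -/
def H1 (F : Eucl n → ℝ → Eucl n → Eucl n) : Prop :=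
  ∀ M : ℝ, 0 < M → ∃ lam : ℝ, 0 < lam ∧
    ∀ x ∈ Metric.ball (0 : Eucl n) 1, ∀ z : ℝ, |z| ≤ M → ∀ p : Eucl n, ‖p‖ ≤ M →
      ∀ ξ : Eucl n, lam * ‖ξ‖ ^ 2 ≤ ⟪fderiv ℝ (F x z) p ξ, ξ⟫_ℝ

/-- (H1) with a prescribed ellipticity function `lam : M ↦ λ(M)`. -/
def H1With (lam : ℝ → ℝ) (F : Eucl n → ℝ → Eucl n → Eucl n) : Prop :=
  ∀ M : ℝ, 0 < M → 0 < lam M ∧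
    ∀ x ∈ Metric.ball (0 : Eucl n) 1, ∀ z : ℝ, |z| ≤ M → ∀ p : Eucl n, ‖p‖ ≤ M →
      ∀ ξ : Eucl n, lam M * ‖ξ‖ ^ 2 ≤ ⟪fderiv ℝ (F x z) p ξ, ξ⟫_ℝ

/-- `div_x F (x, z, p) = ∑ᵢ ∂_{xᵢ} Fᵢ (x, z, p)`. -/
def divx (F : Eucl n → ℝ → Eucl n → Eucl n) (x : Eucl n) (z : ℝ) (p : Eucl n) : ℝ :=
  ∑ i : Fin (n + 1), fderiv ℝ (fun y : Eucl n => F y z p i) x (EuclideanSpace.single i 1)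

/-- `(F, F₀)` is `t`-rescaled with bound function `L : M ↦ L(M)`. -/
def Rescaled (t : ℝ) (L : ℝ → ℝ) (F : Eucl n → ℝ → Eucl n → Eucl n)
    (F₀ : Eucl n → ℝ → Eucl n → ℝ) : Prop :=
  ∀ M : ℝ, 0 < M → ∀ x ∈ Metric.ball (0 : Eucl n) 1, ∀ z : ℝ, |z| ≤ M →
    ∀ p : Eucl n, ‖p‖ ≤ M →
      |(- divx F x z p - ⟪deriv (fun s : ℝ => F x s p) z, p⟫_ℝ + F₀ x z p)| ≤ t * L M ∧
        ‖fderiv ℝ (F x z) p‖ ≤ L M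

/-- The operator `H_t` acting classically on a `C²` function `φ`:
`H_t(φ)(x) = −div_x F − ⟨∂_z F, ∇φ⟩ − tr(D_pF · D²φ) + F₀`, all evaluated at
`(x, φ(x), ∇φ(x))`. -/
def Hop (F : Eucl n → ℝ → Eucl n → Eucl n) (F₀ : Eucl n → ℝ → Eucl n → ℝ)
    (φ : Eucl n → ℝ) (x : Eucl n) : ℝ :=
  - divx F x (φ x) (gradient φ x)
    - ⟪deriv (fun s : ℝ => F x s (gradient φ x)) (φ x), gradient φ x⟫_ℝ
    - ∑ i : Fin (n + 1),
        ⟪fderiv ℝ (F x (φ x)) (gradient φ x)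
          (fderiv ℝ (gradient φ) x (EuclideanSpace.single i 1)), EuclideanSpace.single i 1⟫_ℝ
    + F₀ x (φ x) (gradient φ x)

/-- The admissible class `A_g` for the thin obstacle problem: `W^{1,∞}(B₁)` functions
with boundary value `g` on `∂B₁` which are nonnegative on `B₁'`. -/
def AdmissibleThin (g v : Eucl n → ℝ) : Prop :=
  (∃ C : ℝ≥0, LipschitzOnWith C v (Metric.closedBall (0 : Eucl n) 1)) ∧
    (∀ x ∈ Metric.sphere (0 : Eucl n) 1, v x = g x) ∧
    ∀ x ∈ tBall (0 : Eucl n) 1, 0 ≤ v x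

/-- A (Lipschitz) solution of the thin obstacle problem in `B₁`. -/
def ThinSolution (F : Eucl n → ℝ → Eucl n → Eucl n) (F₀ : Eucl n → ℝ → Eucl n → ℝ)
    (g u : Eucl n → ℝ) : Prop :=
  AdmissibleThin g u ∧
    ∀ v : Eucl n → ℝ, AdmissibleThin g v →
      0 ≤ ∫ x in Metric.ball (0 : Eucl n) 1,
        (⟪F x (u x) (gradient u x), gradient v x - gradient u x⟫_ℝ +
          F₀ x (u x) (gradient u x) * (v x - u x))

/-- The admissible class `A_g` for the boundary (Signorini) obstacle problem:
`W^{1,∞}(B₁⁺)` functions with boundary value `g` on `∂B₁⁺ ∖ B₁'` which are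
nonnegative on `B₁'`. -/
def AdmissibleBdry (g v : Eucl n → ℝ) : Prop :=
  (∃ C : ℝ≥0, LipschitzOnWith C v
      (Metric.closedBall (0 : Eucl n) 1 ∩ {x : Eucl n | 0 ≤ x (Fin.last n)})) ∧
    (∀ x : Eucl n, ‖x‖ = 1 → 0 ≤ x (Fin.last n) → v x = g x) ∧
    ∀ x ∈ tBall (0 : Eucl n) 1, 0 ≤ v x

/-- A (Lipschitz) solution of the boundary (Signorini) obstacle problem in `B₁⁺`. -/
def BdrySolution (F : Eucl n → ℝ → Eucl n → Eucl n) (F₀ : Eucl n → ℝ → Eucl n → ℝ)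
    (g u : Eucl n → ℝ) : Prop :=
  AdmissibleBdry g u ∧
    ∀ v : Eucl n → ℝ, AdmissibleBdry g v →
      0 ≤ ∫ x in hBall (0 : Eucl n) 1,
        (⟪F x (u x) (gradient u x), gradient v x - gradient u x⟫_ℝ +
          F₀ x (u x) (gradient u x) * (v x - u x))

/-- The coincidence set `Λ(u) = {x ∈ B₁' : u(x) = 0}`. -/
def coincidenceSet (u : Eucl n → ℝ) : Set (Eucl n) :=
  {x ∈ tBall (0 : Eucl n) 1 | u x = 0}

/-- The free boundary `Γ(u)`: the boundary of `Λ(u)` in the relative topology of `B₁'`. -/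
def freeBoundary (u : Eucl n → ℝ) : Set (Eucl n) :=
  {x ∈ coincidenceSet u |
    ∀ r : ℝ, 0 < r → ∃ y ∈ tBall (0 : Eucl n) 1, y ∈ Metric.ball x r ∧ 0 < u y}

/-- `w` satisfies the Caccioppoli inequality with constant `Q` at `x₀ ∈ B₁'`. -/
def CaccAt (w : Eucl n → ℝ) (Q : ℝ) (x₀ : Eucl n) : Prop :=
  ∀ k : ℝ, 0 ≤ k → ∀ r R : ℝ, 0 < r → r < R → R < 1 - ‖x₀‖ →
    (∫ x in ({x : Eucl n | k ≤ w x} ∩ hBall x₀ r), ‖gradient w x‖ ^ 2) ≤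
      Q / (R - r) ^ 2 * (∫ x in ({x : Eucl n | k ≤ w x} ∩ hBall x₀ R), (w x - k) ^ 2) +
        Q * (volume ({x : Eucl n | k ≤ w x} ∩ hBall x₀ R)).toReal

/-- Difference quotient `D_e^h w (x) = (w(x + h e) − w(x))/h`. -/
def diffQuot (h : ℝ) (e : Eucl n) (w : Eucl n → ℝ) (x : Eucl n) : ℝ :=
  (w (x + h • e) - w x) / h

/-- The barrier function `η(x) = t(|x' − x₀'|² − K x_{n+1}²) + m x_{n+1} + γ`. -/
def etaFn (x₀ : Eucl n) (t K m γ : ℝ) (x : Eucl n) : ℝ :=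
  t * ((∑ i : Fin n, (x i.castSucc - x₀ i.castSucc) ^ 2) - K * (x (Fin.last n)) ^ 2) +
    m * x (Fin.last n) + γ

end TOP

namespace TOP

lemma exists_lipschitzWith_of_hasCompactSupport {E : Type*} [PseudoMetricSpace E] [ProperSpace E]
    {f : E → ℝ} (hf : LocallyLipschitz f) (hc : HasCompactSupport f) :
    ∃ K : ℝ≥0, LipschitzWith K f := by
  have hT : IsCompact (cthickening 1 (tsupport f)) := hc.isCompact.cthickening
  obtain ⟨K, hK⟩ := (hf.locallyLipschitzOn (s := cthickening 1 (tsupport f)))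
    |>.exists_lipschitzOnWith_of_compact hT
  obtain ⟨B, hB⟩ := hc.exists_bound_of_continuous hf.continuous
  have key : ∀ x y : E, x ∉ cthickening 1 (tsupport f) →
      |f x - f y| ≤ (max K B.toNNReal : ℝ≥0) * dist x y := by
    intro x y hx
    have hx0 : f x = 0 := by
      by_contra h
      exact hx (self_subset_cthickening _ (subset_tsupport f h))
    by_cases hy : y ∈ tsupport f
    · have hd : 1 ≤ dist x y := by
        by_contra! h
        exact hx (mem_cthickening_of_dist_le x y 1 _ hy h.le)
      have hBy := hB y
      rw [hx0, zero_sub, abs_neg, ← Real.norm_eq_abs]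
      have hB' : B ≤ (max K B.toNNReal : ℝ≥0) :=
        (Real.le_coe_toNNReal B).trans (NNReal.coe_le_coe.2 (le_max_right _ _))
      have hnn : (0 : ℝ) ≤ (max K B.toNNReal : ℝ≥0) := NNReal.coe_nonneg _
      nlinarith
    · have hy0 : f y = 0 := image_eq_zero_of_notMem_tsupport hy
      rw [hx0, hy0]
      simp only [sub_zero, abs_zero]
      positivity
  refine ⟨max K B.toNNReal, LipschitzWith.of_dist_le_mul fun x y => ?_⟩
  rw [Real.dist_eq]
  by_cases hx : x ∈ cthickening 1 (tsupport f)
  · by_cases hy : y ∈ cthickening 1 (tsupport f)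
    · have h := hK.dist_le_mul x hx y hy
      rw [Real.dist_eq] at h
      refine h.trans (mul_le_mul_of_nonneg_right ?_ dist_nonneg)
      exact NNReal.coe_le_coe.2 (le_max_left _ _)
    · rw [abs_sub_comm, dist_comm]
      exact key y x hy
  · exact key x y hx

lemma exists_lipschitzOnWith_of_contDiffOn {E G : Type*} [NormedAddCommGroup E] [NormedSpace ℝ E]
    [NormedAddCommGroup G] [NormedSpace ℝ G] {f : E → G} {Ω K : Set E}
    (hf : ContDiffOn ℝ 1 f Ω) (hΩ : IsOpen Ω) (hK : IsCompact K) (hKΩ : K ⊆ Ω) :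
    ∃ k : ℝ≥0, LipschitzOnWith k f K := by
  refine LocallyLipschitzOn.exists_lipschitzOnWith_of_compact hK fun x hx => ?_
  obtain ⟨k, t, ht, hk⟩ := (hf.contDiffAt (hΩ.mem_nhds (hKΩ hx))).exists_lipschitzOnWith
  exact ⟨k, t, mem_nhdsWithin_of_mem_nhds ht, hk⟩

lemma inner_sub_ge_of_fderiv_ge {E : Type*} [NormedAddCommGroup E] [InnerProductSpace ℝ E]
    {F : E → E} (hF : Differentiable ℝ F) {M l : ℝ}
    (h : ∀ p : E, ‖p‖ ≤ M → ∀ ξ : E, l * ‖ξ‖ ^ 2 ≤ ⟪fderiv ℝ F p ξ, ξ⟫_ℝ)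
    {p q : E} (hp : ‖p‖ ≤ M) (hq : ‖q‖ ≤ M) :
    l * ‖q - p‖ ^ 2 ≤ ⟪F q - F p, q - p⟫_ℝ := by
  have hd : ∀ s : ℝ, HasDerivAt (fun s : ℝ => ⟪F (p + s • (q - p)), q - p⟫_ℝ)
      ⟪fderiv ℝ F (p + s • (q - p)) (q - p), q - p⟫_ℝ s := by
    intro s
    have h1 : HasDerivAt (fun s : ℝ => p + s • (q - p)) (q - p) s := by
      simpa using ((hasDerivAt_id s).smul_const (q - p)).const_add p
    have h2 := (hF (p + s • (q - p))).hasFDerivAt.comp_hasDerivAt s h1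
    simpa using h2.inner ℝ (hasDerivAt_const s (q - p))
  have key := (convex_Icc (0 : ℝ) 1).mul_sub_le_image_sub_of_le_deriv
    (f := fun s : ℝ => ⟪F (p + s • (q - p)), q - p⟫_ℝ) (C := l * ‖q - p‖ ^ 2)
    (fun s _ => (hd s).continuousAt.continuousWithinAt)
    (fun s _ => (hd s).differentiableAt.differentiableWithinAt)
    (fun s hs => by
      rw [(hd s).deriv]
      refine h _ ?_ _
      have hs' := interior_subset hs
      have := (convex_closedBall (0 : E) M).add_smul_sub_mem
        (mem_closedBall_zero_iff.2 hp) (mem_closedBall_zero_iff.2 hq) hs'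
      exact mem_closedBall_zero_iff.1 this)
    0 (by simp) 1 (by simp) zero_le_one
  simpa [inner_sub_left] using key

lemma integrable_of_bounded_of_isCompact {n : ℕ} {f : Eucl n → ℝ} {C : Set (Eucl n)}
    (hC : IsCompact C) (hm : AEStronglyMeasurable f (volume.restrict C)) {B : ℝ}
    (hB : ∀ x ∈ C, ‖f x‖ ≤ B) (h0 : ∀ x, x ∉ C → f x = 0) : Integrable f := by
  rw [← integrableOn_iff_integrable_of_support_subset
    (s := C) (fun x hx => by by_contra h; exact hx (h0 x h))]
  have : IsFiniteMeasure (volume.restrict C) := ⟨by simpa using hC.measure_lt_top⟩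
  exact Integrable.of_bound hm B (ae_restrict_of_forall_mem hC.measurableSet hB)

lemma gradient_apply {n : ℕ} (w : Eucl n → ℝ) (x : Eucl n) (i : Fin (n + 1)) :
    gradient w x i = fderiv ℝ w x (EuclideanSpace.single i 1) := by
  have h : ⟪gradient w x, EuclideanSpace.single i (1 : ℝ)⟫_ℝ =
      fderiv ℝ w x (EuclideanSpace.single i 1) := by
    rw [gradient, InnerProductSpace.toDual_symm_apply]
  rw [← h, EuclideanSpace.inner_single_right]
  simp

lemma measurable_gradient {n : ℕ} (w : Eucl n → ℝ) : Measurable (gradient w) :=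
  (InnerProductSpace.toDual ℝ (Eucl n)).symm.continuous.measurable.comp (measurable_fderiv ℝ w)

lemma norm_gradient_le {n : ℕ} {w : Eucl n → ℝ} {K : ℝ≥0} (hw : LipschitzWith K w)
    (x : Eucl n) : ‖gradient w x‖ ≤ K := by
  rw [gradient, LinearIsometryEquiv.norm_map]
  exact norm_fderiv_le_of_lipschitz ℝ hw

lemma gradient_eq_zero_of_notMem_tsupport {n : ℕ} {w : Eucl n → ℝ} {x : Eucl n}
    (hx : x ∉ tsupport w) : gradient w x = 0 := by
  have h : w =ᶠ[𝓝 x] fun _ => 0 := notMem_tsupport_iff_eventuallyEq.1 hx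
  rw [gradient, h.fderiv_eq]
  simp

/-- Integration by parts: a `C¹` vector field against a compactly supported Lipschitz function. -/
lemma integral_inner_gradient_add_div_mul {n : ℕ} {Φ : Eucl n → Eucl n} {Ω C : Set (Eucl n)}
    (hΦ : ContDiffOn ℝ 1 Φ Ω) (hΩ : IsOpen Ω) (hC : IsCompact C) (hCΩ : C ⊆ Ω)
    {w : Eucl n → ℝ} {K : ℝ≥0} (hw : LipschitzWith K w) (hwC : tsupport w ⊆ interior C) :
    Integrable (fun x => ⟪Φ x, gradient w x⟫_ℝ +
      (∑ i, fderiv ℝ (fun y => Φ y i) x (EuclideanSpace.single i 1)) * w x) ∧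
    ∫ x, (⟪Φ x, gradient w x⟫_ℝ +
      (∑ i, fderiv ℝ (fun y => Φ y i) x (EuclideanSpace.single i 1)) * w x) = 0 := by
  have hwc : HasCompactSupport w :=
    hC.of_isClosed_subset (isClosed_tsupport w) (hwC.trans interior_subset)
  have hΦi : ∀ i, ContDiffOn ℝ 1 (fun y => Φ y i) Ω := fun i => contDiffOn_euclidean.1 hΦ i
  have hpt : ∀ x, ⟪Φ x, gradient w x⟫_ℝ +
      (∑ i, fderiv ℝ (fun y => Φ y i) x (EuclideanSpace.single i 1)) * w x =
      ∑ i, (fderiv ℝ w x (EuclideanSpace.single i 1) * Φ x i +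
        fderiv ℝ (fun y => Φ y i) x (EuclideanSpace.single i 1) * w x) := by
    intro x
    rw [Finset.sum_add_distrib, Finset.sum_mul]
    congr 1
    simp only [PiLp.inner_apply, gradient_apply]
    rfl
  simp_rw [hpt]
  have key : ∀ i, (Integrable fun x => fderiv ℝ w x (EuclideanSpace.single i 1) * Φ x i) ∧
      (Integrable fun x => fderiv ℝ (fun y => Φ y i) x (EuclideanSpace.single i 1) * w x) ∧
      (∫ x, fderiv ℝ w x (EuclideanSpace.single i 1) * Φ x i) +
        ∫ x, fderiv ℝ (fun y => Φ y i) x (EuclideanSpace.single i 1) * w x = 0 := by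
    intro i
    set e : Eucl n := EuclideanSpace.single i 1
    obtain ⟨k, hk⟩ := exists_lipschitzOnWith_of_contDiffOn (hΦi i) hΩ hC hCΩ
    obtain ⟨f, hf, hfeq⟩ := hk.extend_real
    have h1 : (fun x => fderiv ℝ w x e * Φ x i) = fun x => fderiv ℝ w x e * f x := by
      funext x
      by_cases hx : x ∈ C
      · rw [← hfeq hx]
      · have hx' : x ∉ tsupport w := fun h => hx (interior_subset (hwC h))
        rw [← gradient_apply, gradient_eq_zero_of_notMem_tsupport hx']
        simp
    have h2 : (fun x => fderiv ℝ (fun y => Φ y i) x e * w x) =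
        fun x => lineDeriv ℝ f x e * w x := by
      funext x
      by_cases hx : x ∈ tsupport w
      · have hxi := hwC hx
        have hev : f =ᶠ[𝓝 x] fun y => Φ y i := by
          filter_upwards [mem_interior_iff_mem_nhds.1 hxi] with y hy using (hfeq hy).symm
        have hd : DifferentiableAt ℝ (fun y => Φ y i) x :=
          ((hΦi i).contDiffAt (hΩ.mem_nhds (hCΩ (interior_subset hxi)))).differentiableAt one_ne_zero
        rw [hev.lineDeriv_eq, hd.lineDeriv_eq_fderiv]
      · rw [image_eq_zero_of_notMem_tsupport hx]
        simp
    have hint2 : Integrable fun x => lineDeriv ℝ f x e * w x :=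
      (hw.continuous.integrable_of_hasCompactSupport hwc).bdd_mul
        (measurable_lineDeriv hf.continuous).aestronglyMeasurable
        (Eventually.of_forall fun x => norm_lineDeriv_le_of_lipschitz ℝ hf)
    obtain ⟨B, hB⟩ := hC.exists_bound_of_continuousOn hf.continuous.continuousOn
    have hint1 : Integrable fun x => fderiv ℝ w x e * f x := by
      refine integrable_of_bounded_of_isCompact hC (B := K * ‖e‖ * B) ?_ (fun x hx => ?_)
        (fun x hx => ?_)
      · exact ((measurable_fderiv_apply_const ℝ w e).mul
          hf.continuous.measurable).aestronglyMeasurable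
      · rw [norm_mul]
        have hle : ‖fderiv ℝ w x e‖ ≤ K * ‖e‖ :=
          (ContinuousLinearMap.le_opNorm _ _).trans
            (mul_le_mul_of_nonneg_right (norm_fderiv_le_of_lipschitz ℝ hw) (norm_nonneg _))
        exact mul_le_mul hle (hB x hx) (norm_nonneg _) (by positivity)
      · have hx' : x ∉ tsupport w := fun h => hx (interior_subset (hwC h))
        rw [← gradient_apply, gradient_eq_zero_of_notMem_tsupport hx']
        simp
    rw [h1, h2]
    refine ⟨hint1, hint2, ?_⟩
    rw [hf.integral_lineDeriv_mul_eq hw hwc e]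
    have hae : ∀ᵐ x, lineDeriv ℝ w x (-e) * f x = -(fderiv ℝ w x e * f x) := by
      filter_upwards [hw.ae_differentiableAt] with x hx
      rw [hx.lineDeriv_eq_fderiv, map_neg, neg_mul]
    rw [integral_congr_ae hae, integral_neg, add_neg_cancel]
  have hint := fun i => (key i).1.fun_add (key i).2.1
  refine ⟨integrable_finsetSum _ fun i _ => hint i, ?_⟩
  rw [integral_finsetSum _ fun i _ => hint i]
  refine Finset.sum_eq_zero fun i _ => ?_
  rw [integral_add (key i).1 (key i).2.1]
  exact (key i).2.2

end TOP
namespace TOP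

lemma measurable_indicator_of_continuousOn {E G : Type*} [TopologicalSpace E] [MeasurableSpace E]
    [OpensMeasurableSpace E] [TopologicalSpace G] [MeasurableSpace G] [BorelSpace G] [Zero G]
    {f : E → G} {s : Set E} (hf : ContinuousOn f s) (hs : MeasurableSet s) :
    Measurable (s.indicator f) := by
  classical
  rw [← Set.piecewise_eq_indicator]
  exact hf.measurable_piecewise continuousOn_const hs

set_option maxHeartbeats 600000 in
/-- Comparison with a strict classical supersolution `φ` of gradient `G`: a small nonnegative
truncation `w` of `U - φ` tested against the equation of `U` with the sign of a subsolution
vanishes. -/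
lemma exists_gap_of_strict_supersolution {n : ℕ} {F : Eucl n → ℝ → Eucl n → Eucl n}
    {F₀ : Eucl n → ℝ → Eucl n → ℝ} {lam : ℝ → ℝ} (h0 : H0 F F₀) (h1 : H1With lam F)
    {C : Set (Eucl n)} (hC : IsCompact C) (hCB : C ⊆ ball 0 1)
    {U : Eucl n → ℝ} {KU : ℝ≥0} (hU : LipschitzWith KU U) (M : ℝ) {c : ℝ} (hc : 0 < c) :
    ∃ δ : ℝ, 0 < δ ∧ ∀ (φ : Eucl n → ℝ) (G : Eucl n → Eucl n),
      ContDiff ℝ 1 φ → ContDiff ℝ 1 G → (∀ x, HasGradientAt φ (G x) x) →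
      (∀ x ∈ C, |φ x| ≤ M) → (∀ x ∈ C, ‖G x‖ ≤ M) →
      (∀ x ∈ C, c ≤ F₀ x (φ x) (G x) -
        ∑ i, fderiv ℝ (fun y => F y (φ y) (G y) i) x (EuclideanSpace.single i 1)) →
      ∀ (w : Eucl n → ℝ) (Kw : ℝ≥0), LipschitzWith Kw w → tsupport w ⊆ interior C →
        (∀ x, 0 ≤ w x) → (∀ x, w x ≤ δ) → (∀ x, w x ≠ 0 → w x = U x - φ x) →
        ∫ x, (⟪F x (U x) (gradient U x), gradient w x⟫_ℝ +
          F₀ x (U x) (gradient U x) * w x) ≤ 0 →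
        ∀ x, w x = 0 := by
  set Ω : Set (Eucl n × ℝ × Eucl n) := ball (0 : Eucl n) 1 ×ˢ Set.univ ×ˢ Set.univ with hΩdef
  have hΩ : IsOpen Ω := isOpen_ball.prod (isOpen_univ.prod isOpen_univ)
  obtain ⟨hF, hF₀⟩ := h0
  obtain ⟨BU, hBU⟩ := hC.exists_bound_of_continuousOn hU.continuous.continuousOn
  set M' : ℝ := |M| + KU + |BU| + 1 with hM'
  have hM'pos : 0 < M' := by positivity
  have hMM' : M ≤ M' := by
    have := le_abs_self M; have := abs_nonneg BU; have := KU.coe_nonneg; linarith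
  have hKM' : (KU : ℝ) ≤ M' := by
    have := abs_nonneg M; have := abs_nonneg BU; linarith
  have hBM' : BU ≤ M' := by
    have := abs_nonneg M; have := le_abs_self BU; have := KU.coe_nonneg; linarith
  set Kc : Set (Eucl n × ℝ × Eucl n) := C ×ˢ closedBall (0 : ℝ) M' ×ˢ closedBall (0 : Eucl n) M'
    with hKcdef
  have hKc : IsCompact Kc :=
    hC.prod ((isCompact_closedBall _ _).prod (isCompact_closedBall _ _))
  have hKcΩ : Kc ⊆ Ω := fun q hq => ⟨hCB hq.1, trivial, trivial⟩
  have hmem : ∀ x ∈ C, ∀ z : ℝ, |z| ≤ M' → ∀ p : Eucl n, ‖p‖ ≤ M' → (x, z, p) ∈ Kc := by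
    intro x hx z hz p hp
    exact ⟨hx, by simpa using hz, by simpa using hp⟩
  obtain ⟨k1, hk1⟩ := exists_lipschitzOnWith_of_contDiffOn hF hΩ hKc hKcΩ
  obtain ⟨k2, hk2⟩ := exists_lipschitzOnWith_of_contDiffOn hF₀ hΩ hKc hKcΩ
  obtain ⟨BF, hBF⟩ := hKc.exists_bound_of_continuousOn (hF.continuousOn.mono hKcΩ)
  obtain ⟨BF₀, hBF₀⟩ := hKc.exists_bound_of_continuousOn (hF₀.continuousOn.mono hKcΩ)
  obtain ⟨hl, hell⟩ := h1 M' hM'pos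
  set l := lam M'
  set k : ℝ := k1 + k2 with hk
  have hk0 : 0 ≤ k := by positivity
  have hA : 0 < k ^ 2 / l + k + 1 := by positivity
  refine ⟨c / (2 * (k ^ 2 / l + k + 1)), by positivity, ?_⟩
  intro φ G hφ hG hφG hφM hGM hsup w Kw hw hwC hw0 hwδ hwU hint
  have hUM : ∀ x ∈ C, |U x| ≤ M' := fun x hx => (hBU x hx).trans hBM'
  have hgUM : ∀ x, ‖gradient U x‖ ≤ M' := fun x => (norm_gradient_le hU x).trans hKM'
  have hwc : HasCompactSupport w :=
    hC.of_isClosed_subset (isClosed_tsupport w) (hwC.trans interior_subset)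
  have hwz : ∀ x, w x = 0 → gradient w x = 0 := by
    intro x hx
    have hmin : IsLocalMin w x := Eventually.of_forall fun y => by rw [hx]; exact hw0 y
    rw [gradient, hmin.fderiv_eq_zero, map_zero]
  have hΦ : ContDiffOn ℝ 1 (fun y => F y (φ y) (G y)) (ball (0 : Eucl n) 1) :=
    hF.comp (f := fun y => (y, φ y, G y)) (contDiff_id.prodMk (hφ.prodMk hG)).contDiffOn
      (fun y hy => ⟨hy, trivial, trivial⟩)
  obtain ⟨hPint, hP⟩ := integral_inner_gradient_add_div_mul hΦ isOpen_ball hC hCB hw hwC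
  have hIint : Integrable fun x => ⟪F x (U x) (gradient U x), gradient w x⟫_ℝ +
      F₀ x (U x) (gradient U x) * w x := by
    have hmeas : Measurable fun x => (x, U x, gradient U x) :=
      measurable_id.prodMk (hU.continuous.measurable.prodMk (measurable_gradient U))
    refine integrable_of_bounded_of_isCompact hC (B := BF * Kw + BF₀ *
      (c / (2 * (k ^ 2 / l + k + 1)))) ?_ (fun x hx => ?_) (fun x hx => ?_)
    · have hFm : Measurable (Ω.indicator fun q => F q.1 q.2.1 q.2.2) :=
        measurable_indicator_of_continuousOn hF.continuousOn hΩ.measurableSet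
      have hF₀m : Measurable (Ω.indicator fun q => F₀ q.1 q.2.1 q.2.2) :=
        measurable_indicator_of_continuousOn hF₀.continuousOn hΩ.measurableSet
      have hm := ((hFm.comp hmeas).inner (𝕜 := ℝ) (measurable_gradient w)).add
        ((hF₀m.comp hmeas).mul hw.continuous.measurable)
      refine hm.aestronglyMeasurable.congr ?_
      refine ae_restrict_of_forall_mem hC.measurableSet fun x hx => ?_
      have hxΩ : (x, U x, gradient U x) ∈ Ω := ⟨hCB hx, trivial, trivial⟩
      simp [Set.indicator_of_mem hxΩ]
    · have hq := hmem x hx _ (hUM x hx) _ (hgUM x)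
      have hb : ‖F x (U x) (gradient U x)‖ ≤ BF := hBF (x, U x, gradient U x) hq
      have hb₀ : ‖F₀ x (U x) (gradient U x)‖ ≤ BF₀ := hBF₀ (x, U x, gradient U x) hq
      refine (norm_add_le _ _).trans (add_le_add ?_ ?_)
      · refine (norm_inner_le_norm _ _).trans ?_
        exact mul_le_mul hb (norm_gradient_le hw x) (norm_nonneg _)
          ((norm_nonneg _).trans hb)
      · rw [norm_mul]
        refine mul_le_mul hb₀ ?_ (norm_nonneg _) ((norm_nonneg _).trans hb₀)
        rw [Real.norm_eq_abs, abs_of_nonneg (hw0 x)]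
        exact hwδ x
    · have hx' : w x = 0 := image_eq_zero_of_notMem_tsupport
        fun h => hx (interior_subset (hwC h))
      simp [hx', hwz x hx']
  have hwint : Integrable w := hw.continuous.integrable_of_hasCompactSupport hwc
  have hpt : ∀ᵐ x, (⟪F x (φ x) (G x), gradient w x⟫_ℝ +
      (∑ i, fderiv ℝ (fun y => F y (φ y) (G y) i) x (EuclideanSpace.single i 1)) * w x) +
      c / 2 * w x ≤ ⟪F x (U x) (gradient U x), gradient w x⟫_ℝ +
        F₀ x (U x) (gradient U x) * w x := by
    filter_upwards [hU.ae_differentiableAt] with x hUx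
    by_cases hx : w x = 0
    · simp [hx, hwz x hx]
    have hxC : x ∈ C := interior_subset (hwC (subset_tsupport w hx))
    have hWpos : 0 < w x := lt_of_le_of_ne (hw0 x) (Ne.symm hx)
    have hgrad : gradient U x = G x + gradient w x := by
      have hev : w =ᶠ[𝓝 x] fun y => U y - φ y := by
        filter_upwards [hw.continuous.continuousAt.eventually_ne hx] with y hy using hwU y hy
      have hd : HasFDerivAt w (fderiv ℝ U x - InnerProductSpace.toDual ℝ _ (G x)) x :=
        (hUx.hasFDerivAt.sub (hφG x).hasFDerivAt).congr_of_eventuallyEq hev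
      rw [gradient, gradient, hd.fderiv, map_sub]
      simp
    have hUeq : U x = φ x + w x := by rw [hwU x hx]; ring
    set W := w x with hW
    set q := gradient w x with hqdef
    set Q := ‖q‖ with hQ
    have hQ0 : 0 ≤ Q := norm_nonneg _
    have hm1 := hmem x hxC _ (hUM x hxC) _ (hgUM x)
    have hm2 := hmem x hxC _ (hUM x hxC) _ ((hGM x hxC).trans hMM')
    have hm3 := hmem x hxC _ ((hφM x hxC).trans hMM') _ ((hGM x hxC).trans hMM')
    have hFd : Differentiable ℝ (F x (U x)) := by
      intro p
      have hd := (hF.contDiffAt (x := (x, U x, p))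
        (hΩ.mem_nhds ⟨hCB hxC, trivial, trivial⟩)).differentiableAt one_ne_zero
      exact hd.comp p (f := fun p => (x, U x, p)) (by fun_prop)
    have hmono : l * Q ^ 2 ≤ ⟪F x (U x) (gradient U x) - F x (U x) (G x), q⟫_ℝ := by
      have := inner_sub_ge_of_fderiv_ge hFd (hell x (hCB hxC) (U x) (hUM x hxC))
        ((hGM x hxC).trans hMM') (hgUM x)
      rwa [show gradient U x - G x = q by rw [hgrad]; abel] at this
    have hzl : ‖F x (U x) (G x) - F x (φ x) (G x)‖ ≤ k1 * W := by
      have h := hk1.dist_le_mul _ hm2 _ hm3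
      rw [dist_eq_norm] at h
      refine h.trans_eq ?_
      simp [Prod.dist_eq, hUeq, abs_of_pos hWpos, hWpos.le]
    have hzl' : -(k1 * W * Q) ≤ ⟪F x (U x) (G x) - F x (φ x) (G x), q⟫_ℝ := by
      have h := abs_real_inner_le_norm (F x (U x) (G x) - F x (φ x) (G x)) q
      have h' := mul_le_mul_of_nonneg_right hzl hQ0
      exact (abs_le.1 (h.trans h')).1
    have hF₀l : -(k2 * (W + Q)) ≤ F₀ x (U x) (gradient U x) - F₀ x (φ x) (G x) := by
      have h := hk2.dist_le_mul _ hm1 _ hm3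
      rw [Real.dist_eq] at h
      refine (abs_le.1 (h.trans ?_)).1
      refine mul_le_mul_of_nonneg_left ?_ k2.coe_nonneg
      rw [Prod.dist_eq, Prod.dist_eq, hUeq, hgrad]
      simp only [dist_self, dist_self_add_left, Real.norm_eq_abs, abs_of_pos hWpos]
      exact max_le (by linarith) (max_le (by linarith) (by linarith))
    have hsplit : ⟪F x (U x) (gradient U x), q⟫_ℝ =
        ⟪F x (U x) (gradient U x) - F x (U x) (G x), q⟫_ℝ +
        ⟪F x (U x) (G x) - F x (φ x) (G x), q⟫_ℝ + ⟪F x (φ x) (G x), q⟫_ℝ := by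
      rw [← inner_add_left, ← inner_add_left]; congr 1; abel
    have hs := hsup x hxC
    have hδ : (k ^ 2 / l + k + 1) * W ≤ c / 2 := by
      have := mul_le_mul_of_nonneg_left (hwδ x) hA.le
      refine this.trans_eq ?_
      field_simp
    have hsq : -(k ^ 2 / l * W ^ 2) ≤ l * Q ^ 2 - 2 * (k * W * Q) := by
      have h : l * Q ^ 2 - 2 * (k * W * Q) + k ^ 2 / l * W ^ 2 = (l * Q - k * W) ^ 2 / l := by
        field_simp
        ring
      have h' : 0 ≤ (l * Q - k * W) ^ 2 / l := by positivity
      linarith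
    rw [hsplit]
    have e1 := mul_le_mul_of_nonneg_right hF₀l hWpos.le
    have e2 := mul_le_mul_of_nonneg_right hs hWpos.le
    have e3 := mul_le_mul_of_nonneg_right hδ hWpos.le
    have e4 : (k1 : ℝ) * W * Q ≤ k * W * Q := by
      have : 0 ≤ (k2 : ℝ) * (W * Q) := by positivity
      rw [hk]; linarith
    have e5 : (k2 : ℝ) * (W + Q) * W ≤ k * W ^ 2 + k * W * Q := by
      have : 0 ≤ (k1 : ℝ) * (W * (W + Q)) := by positivity
      rw [hk]; linarith
    have e6 : 0 ≤ W ^ 2 := by positivity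
    linarith
  have hle := integral_mono_ae (hPint.add (hwint.const_mul (c / 2))) hIint hpt
  rw [integral_add' hPint (hwint.const_mul (c / 2)), hP, zero_add, integral_const_mul] at hle
  by_contra! hne
  obtain ⟨x, hx⟩ := hne
  have hpos := hw.continuous.integral_pos_of_hasCompactSupport_nonneg_nonzero
    (μ := (volume : Measure (Eucl n))) hwc hw0 hx
  have : 0 < c / 2 * ∫ x, w x := by positivity
  linarith

end TOP
namespace TOP

/-- The barrier `t |x - x₀|² - s x_{n+1}² + m x_{n+1} + γ`. -/
def quadBarrier {n : ℕ} (x₀ : Eucl n) (t s m γ : ℝ) (x : Eucl n) : ℝ :=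
  t * ‖x - x₀‖ ^ 2 - s * x (Fin.last n) ^ 2 + m * x (Fin.last n) + γ

/-- The gradient of `quadBarrier`. -/
def quadBarrierGrad {n : ℕ} (x₀ : Eucl n) (t s m : ℝ) (x : Eucl n) : Eucl n :=
  (2 * t) • (x - x₀) + (m - 2 * s * x (Fin.last n)) • eLast n

lemma contDiff_apply_last (n : ℕ) : ContDiff ℝ 1 fun x : Eucl n => x (Fin.last n) :=
  contDiff_euclidean.1 contDiff_id _

lemma contDiff_quadBarrier {n : ℕ} (x₀ : Eucl n) (t s m γ : ℝ) :
    ContDiff ℝ 1 (quadBarrier x₀ t s m γ) := by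
  have h := contDiff_apply_last n
  have h2 : ContDiff ℝ 1 fun x : Eucl n => ‖x - x₀‖ ^ 2 :=
    (contDiff_id.sub contDiff_const).norm_sq ℝ
  exact (((contDiff_const.mul h2).sub (contDiff_const.mul (h.pow 2))).add
    (contDiff_const.mul h)).add contDiff_const

lemma contDiff_quadBarrierGrad {n : ℕ} (x₀ : Eucl n) (t s m : ℝ) :
    ContDiff ℝ 1 (quadBarrierGrad x₀ t s m) := by
  have h := contDiff_apply_last n
  exact ((contDiff_id.sub contDiff_const).const_smul (2 * t)).add
    ((contDiff_const.sub (contDiff_const.mul h)).smul contDiff_const)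

lemma inner_eLast {n : ℕ} (x : Eucl n) : ⟪x, eLast n⟫_ℝ = x (Fin.last n) := by
  rw [eLast, EuclideanSpace.inner_single_right]
  simp

lemma hasFDerivAt_apply_last {n : ℕ} (x : Eucl n) :
    HasFDerivAt (fun x : Eucl n => x (Fin.last n))
      (EuclideanSpace.proj (Fin.last n) : Eucl n →L[ℝ] ℝ) x :=
  (EuclideanSpace.proj (Fin.last n) : Eucl n →L[ℝ] ℝ).hasFDerivAt

lemma hasGradientAt_quadBarrier {n : ℕ} (x₀ : Eucl n) (t s m γ : ℝ) (x : Eucl n) :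
    HasGradientAt (quadBarrier x₀ t s m γ) (quadBarrierGrad x₀ t s m x) x := by
  have h := hasFDerivAt_apply_last x
  have h2 : HasFDerivAt (fun x : Eucl n => ‖x - x₀‖ ^ 2) (2 • innerSL ℝ (x - x₀)) x := by
    simpa using ((hasFDerivAt_id x).sub_const x₀).norm_sq
  have h3 := (((h2.const_mul t).sub ((h.pow 2).const_mul s)).add (h.const_mul m)).add_const γ
  rw [hasGradientAt_iff_hasFDerivAt]
  refine h3.congr_fderiv ?_
  ext v
  have hv : ⟪eLast n, v⟫_ℝ = v (Fin.last n) := by rw [real_inner_comm, inner_eLast]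
  simp [quadBarrierGrad, hv]
  ring

lemma hasFDerivAt_quadBarrierGrad {n : ℕ} (x₀ : Eucl n) (t s m : ℝ) (x : Eucl n) :
    HasFDerivAt (quadBarrierGrad x₀ t s m)
      ((2 * t) • ContinuousLinearMap.id ℝ (Eucl n) -
        ((2 * s) • (EuclideanSpace.proj (Fin.last n) : Eucl n →L[ℝ] ℝ)).smulRight (eLast n)) x := by
  have h := (((hasFDerivAt_apply_last x).const_mul (2 * s)).const_sub m).smul_const (eLast n)
  have h2 := (((hasFDerivAt_id x).sub_const x₀).const_smul (2 * t)).add h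
  refine h2.congr_fderiv ?_
  ext v
  simp [sub_eq_add_neg]

/-- The chain rule for the divergence of `y ↦ F(y, φ(y), ∇φ(y))` when `D²φ` is diagonal. -/
lemma sum_fderiv_comp_eq {n : ℕ} {F : Eucl n → ℝ → Eucl n → Eucl n}
    {x : Eucl n} {φ : Eucl n → ℝ} {G : Eucl n → Eucl n} {G' : Eucl n →L[ℝ] Eucl n}
    {ν : Fin (n + 1) → ℝ}
    (hF : DifferentiableAt ℝ (fun q : Eucl n × ℝ × Eucl n => F q.1 q.2.1 q.2.2) (x, φ x, G x))
    (hφ : HasGradientAt φ (G x) x) (hG : HasFDerivAt G G' x)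
    (hν : ∀ i, G' (EuclideanSpace.single i 1) = ν i • EuclideanSpace.single i 1) :
    ∑ i, fderiv ℝ (fun y => F y (φ y) (G y) i) x (EuclideanSpace.single i 1) =
      divx F x (φ x) (G x) + ⟪deriv (fun s : ℝ => F x s (G x)) (φ x), G x⟫_ℝ +
        ∑ i, ν i * ⟪fderiv ℝ (F x (φ x)) (G x) (EuclideanSpace.single i 1),
          EuclideanSpace.single i (1 : ℝ)⟫_ℝ := by
  set A := fderiv ℝ (fun q : Eucl n × ℝ × Eucl n => F q.1 q.2.1 q.2.2) (x, φ x, G x) with hA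
  have hFA := hF.hasFDerivAt
  rw [← hA] at hFA
  have hproj : ∀ (i : Fin (n + 1)) {f : Eucl n → Eucl n} {f' : Eucl n →L[ℝ] Eucl n},
      HasFDerivAt f f' x → ∀ v, fderiv ℝ (fun y => f y i) x v = f' v i := by
    intro i f f' hf v
    have h := (EuclideanSpace.proj i : Eucl n →L[ℝ] ℝ).hasFDerivAt.comp x hf
    have h' : HasFDerivAt (fun y => f y i)
      ((EuclideanSpace.proj i : Eucl n →L[ℝ] ℝ).comp f') x := h
    rw [h'.fderiv]
    rfl
  have h1 : HasFDerivAt (fun y => F y (φ y) (G y))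
      (A.comp ((ContinuousLinearMap.id ℝ (Eucl n)).prod
        ((InnerProductSpace.toDual ℝ _ (G x)).prod G'))) x :=
    HasFDerivAt.comp x (f := fun y => (y, φ y, G y)) hFA
      ((hasFDerivAt_id x).prodMk (hφ.hasFDerivAt.prodMk hG))
  have h2 : HasFDerivAt (fun y => F y (φ x) (G x))
      (A.comp ((ContinuousLinearMap.id ℝ (Eucl n)).prod 0)) x :=
    HasFDerivAt.comp x (f := fun y => (y, φ x, G x)) hFA
      ((hasFDerivAt_id x).prodMk (hasFDerivAt_const (φ x, G x) x))
  have h3 : HasDerivAt (fun s => F x s (G x)) (A (0, 1, 0)) (φ x) :=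
    HasFDerivAt.comp_hasDerivAt (φ x) (f := fun s => (x, s, G x)) hFA
      ((hasDerivAt_const _ x).prodMk ((hasDerivAt_id _).prodMk (hasDerivAt_const _ (G x))))
  have h4 : HasFDerivAt (F x (φ x))
      (A.comp ((0 : Eucl n →L[ℝ] Eucl n).prod
        ((0 : Eucl n →L[ℝ] ℝ).prod (ContinuousLinearMap.id ℝ (Eucl n))))) (G x) :=
    HasFDerivAt.comp (G x) (f := fun p => (x, φ x, p)) hFA
      ((hasFDerivAt_const x _).prodMk ((hasFDerivAt_const (φ x) _).prodMk (hasFDerivAt_id _)))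
  rw [divx, h3.deriv, h4.fderiv, PiLp.inner_apply, ← Finset.sum_add_distrib,
    ← Finset.sum_add_distrib]
  refine Finset.sum_congr rfl fun i _ => ?_
  rw [hproj i h1, hproj i h2, EuclideanSpace.inner_single_right]
  have hGi : ⟪G x, EuclideanSpace.single i (1 : ℝ)⟫_ℝ = G x i := by
    rw [EuclideanSpace.inner_single_right]; simp
  have hdec : ((EuclideanSpace.single i (1 : ℝ) : Eucl n), G x i,
      ν i • (EuclideanSpace.single i (1 : ℝ) : Eucl n)) =
      ((EuclideanSpace.single i (1 : ℝ) : Eucl n), (0 : ℝ), (0 : Eucl n)) +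
      G x i • ((0 : Eucl n), (1 : ℝ), (0 : Eucl n)) +
      ν i • ((0 : Eucl n), (0 : ℝ), (EuclideanSpace.single i (1 : ℝ) : Eucl n)) := by
    simp
  have hL : (A.comp ((ContinuousLinearMap.id ℝ (Eucl n)).prod
        ((InnerProductSpace.toDual ℝ _ (G x)).prod G'))) (EuclideanSpace.single i 1) =
      A ((EuclideanSpace.single i (1 : ℝ) : Eucl n), G x i,
      ν i • (EuclideanSpace.single i (1 : ℝ) : Eucl n)) := by
    simp [hν, hGi]
  rw [hL, hdec, map_add, map_add, map_smul, map_smul]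
  simp
  rfl

lemma H0.differentiableAt {n : ℕ} {F : Eucl n → ℝ → Eucl n → Eucl n}
    {F₀ : Eucl n → ℝ → Eucl n → ℝ} (h0 : H0 F F₀) {x : Eucl n} (hx : x ∈ ball (0 : Eucl n) 1)
    (z : ℝ) (p : Eucl n) :
    DifferentiableAt ℝ (fun q : Eucl n × ℝ × Eucl n => F q.1 q.2.1 q.2.2) (x, z, p) := by
  have hΩ : IsOpen (ball (0 : Eucl n) 1 ×ˢ (Set.univ : Set ℝ) ×ˢ (Set.univ : Set (Eucl n))) :=
    isOpen_ball.prod (isOpen_univ.prod isOpen_univ)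
  have hmem : (x, z, p) ∈
      ball (0 : Eucl n) 1 ×ˢ (Set.univ : Set ℝ) ×ˢ (Set.univ : Set (Eucl n)) :=
    ⟨hx, trivial, trivial⟩
  exact (h0.1.contDiffAt (hΩ.mem_nhds hmem)).differentiableAt one_ne_zero

lemma quadBarrier_strict_supersolution {n : ℕ} {F : Eucl n → ℝ → Eucl n → Eucl n}
    {F₀ : Eucl n → ℝ → Eucl n → ℝ} {lam L : ℝ → ℝ} {ε M : ℝ} (hM : 0 < M) (h0 : H0 F F₀)
    (h1 : H1With lam F) (hr : Rescaled ε L F F₀) {x₀ x : Eucl n} {t s m γ : ℝ} (ht : 0 ≤ t)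
    (hs : 0 ≤ s) (hx : x ∈ ball (0 : Eucl n) 1) (hφ : |quadBarrier x₀ t s m γ x| ≤ M)
    (hG : ‖quadBarrierGrad x₀ t s m x‖ ≤ M) :
    2 * s * lam M - 2 * t * (n + 1) * L M - ε * L M ≤
      F₀ x (quadBarrier x₀ t s m γ x) (quadBarrierGrad x₀ t s m x) -
        ∑ i, fderiv ℝ (fun y => F y (quadBarrier x₀ t s m γ y)
          (quadBarrierGrad x₀ t s m y) i) x (EuclideanSpace.single i 1) := by
  have hF : DifferentiableAt ℝ (fun q : Eucl n × ℝ × Eucl n => F q.1 q.2.1 q.2.2)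
      (x, quadBarrier x₀ t s m γ x, quadBarrierGrad x₀ t s m x) :=
    h0.differentiableAt hx _ _
  rw [sum_fderiv_comp_eq (ν := fun i => 2 * t - if i = Fin.last n then 2 * s else 0) hF
    (hasGradientAt_quadBarrier x₀ t s m γ x) (hasFDerivAt_quadBarrierGrad x₀ t s m x) ?_]
  · set φx := quadBarrier x₀ t s m γ x
    set Gx := quadBarrierGrad x₀ t s m x
    obtain ⟨hr1, hr2⟩ := hr M hM x hx φx hφ Gx hG
    have hell := (h1 M hM).2 x hx φx hφ Gx hG
    set D := fderiv ℝ (F x φx) Gx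
    have hdiag : ∀ i, ⟪D (EuclideanSpace.single i 1), EuclideanSpace.single i (1 : ℝ)⟫_ℝ ≤ L M := by
      intro i
      refine (real_inner_le_norm _ _).trans ?_
      have := D.le_opNorm (EuclideanSpace.single i (1 : ℝ))
      simp only [PiLp.norm_single, norm_one, mul_one] at this ⊢
      exact this.trans hr2
    have hlast := hell (EuclideanSpace.single (Fin.last n) 1)
    simp only [PiLp.norm_single, norm_one, one_pow, mul_one] at hlast
    have hsum : ∑ i, ⟪D (EuclideanSpace.single i 1), EuclideanSpace.single i (1 : ℝ)⟫_ℝ ≤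
        (n + 1) * L M := by
      refine (Finset.sum_le_sum fun i _ => hdiag i).trans_eq ?_
      simp
    have e1 := mul_le_mul_of_nonneg_left hsum (mul_nonneg zero_le_two ht)
    have e2 := mul_le_mul_of_nonneg_left hlast (mul_nonneg zero_le_two hs)
    have e3 := (abs_le.1 hr1).1
    simp only [sub_mul, ite_mul, zero_mul, Finset.sum_sub_distrib, ← Finset.mul_sum,
      Finset.sum_ite_eq', Finset.mem_univ, if_true]
    linarith
  · intro i
    by_cases hi : i = Fin.last n
    · subst hi
      simp [eLast, sub_smul]
    · have hi' : Fin.last n ≠ i := fun h => hi h.symm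
      simp [hi, hi']

lemma abs_apply_last_le {n : ℕ} (x : Eucl n) : |x (Fin.last n)| ≤ ‖x‖ := by
  simpa using PiLp.norm_apply_le x (Fin.last n)

lemma norm_eLast (n : ℕ) : ‖eLast n‖ = 1 := by simp [eLast]

lemma abs_quadBarrier_le {n : ℕ} {x₀ x : Eucl n} {t s m γ : ℝ} (ht : 0 ≤ t) (hts : t ≤ s)
    (hs : s ≤ 1) (hx₀ : x₀ (Fin.last n) = 0) (hx : ‖x - x₀‖ ≤ 1 / 4) (hγ : |γ| ≤ 1) :
    |quadBarrier x₀ t s m γ x| ≤ |m| + 3 := by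
  have hy : |x (Fin.last n)| ≤ 1 / 4 := by
    have := abs_apply_last_le (x - x₀)
    rw [PiLp.sub_apply, hx₀, sub_zero] at this
    exact this.trans hx
  have hm : |m * x (Fin.last n)| ≤ |m| := by
    rw [abs_mul]
    nlinarith [abs_nonneg m, abs_nonneg (x (Fin.last n))]
  have hy2 : x (Fin.last n) ^ 2 ≤ 1 := by
    rw [← sq_abs]; nlinarith [abs_nonneg (x (Fin.last n))]
  have hx2 : ‖x - x₀‖ ^ 2 ≤ 1 := by nlinarith [norm_nonneg (x - x₀)]
  have h1 : t * ‖x - x₀‖ ^ 2 ≤ 1 := by nlinarith [sq_nonneg ‖x - x₀‖]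
  have h2 : s * x (Fin.last n) ^ 2 ≤ 1 := by nlinarith [sq_nonneg (x (Fin.last n))]
  have h3 : 0 ≤ t * ‖x - x₀‖ ^ 2 := by positivity
  have h4 : 0 ≤ s * x (Fin.last n) ^ 2 := mul_nonneg (ht.trans hts) (sq_nonneg _)
  rw [quadBarrier, abs_le]
  constructor <;> linarith [abs_le.1 hm, abs_le.1 hγ, (abs_le.1 hm).1, (abs_le.1 hm).2,
    (abs_le.1 hγ).1, (abs_le.1 hγ).2]

lemma norm_quadBarrierGrad_le {n : ℕ} {x₀ x : Eucl n} {t s m : ℝ} (ht : 0 ≤ t) (hts : t ≤ s)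
    (hs : s ≤ 1) (hx₀ : x₀ (Fin.last n) = 0) (hx : ‖x - x₀‖ ≤ 1 / 4) :
    ‖quadBarrierGrad x₀ t s m x‖ ≤ |m| + 3 := by
  have hy : |x (Fin.last n)| ≤ 1 / 4 := by
    have := abs_apply_last_le (x - x₀)
    rw [PiLp.sub_apply, hx₀, sub_zero] at this
    exact this.trans hx
  refine (norm_add_le _ _).trans ?_
  rw [norm_smul, norm_smul, norm_eLast, mul_one, Real.norm_eq_abs, Real.norm_eq_abs,
    abs_of_nonneg (by positivity)]
  have h1 : |m - 2 * s * x (Fin.last n)| ≤ |m| + 2 * s * |x (Fin.last n)| := by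
    refine (abs_sub _ _).trans_eq ?_
    rw [abs_mul, abs_of_nonneg (by linarith : 0 ≤ 2 * s)]
  nlinarith [abs_nonneg (x (Fin.last n)), norm_nonneg (x - x₀)]

lemma quadBarrier_add_smul_eLast {n : ℕ} {x₀ x : Eucl n} (t s m γ : ℝ)
    (hx₀ : x₀ (Fin.last n) = 0) (hx : x (Fin.last n) = 0) (r : ℝ) :
    quadBarrier x₀ t s m γ (x + r • eLast n) =
      quadBarrier x₀ t s m γ x + (t - s) * r ^ 2 + m * r := by
  have h : ‖x + r • eLast n - x₀‖ ^ 2 = ‖x - x₀‖ ^ 2 + r ^ 2 := by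
    rw [show x + r • eLast n - x₀ = (x - x₀) + r • eLast n by abel, norm_add_sq_real,
      inner_smul_right, inner_eLast, norm_smul, norm_eLast]
    simp [hx, hx₀]
  have hl : (x + r • eLast n) (Fin.last n) = r := by simp [eLast, hx]
  rw [quadBarrier, quadBarrier, h, hl, hx]
  ring

end TOP
namespace TOP

lemma exists_lipschitzWith_truncation {E : Type*} [MetricSpace E] [ProperSpace E]
    {ψ : E → ℝ} (hψ : LocallyLipschitz ψ) {D C : Set E} (hD : IsOpen D) (hC : IsCompact C)
    (hDC : D ⊆ C) (h : ∀ x ∈ C, 0 ≤ ψ x → x ∈ D) :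
    (∃ K : ℝ≥0, LipschitzWith K (D.indicator fun x => max (ψ x) 0)) ∧
      tsupport (D.indicator fun x => max (ψ x) 0) ⊆ D := by
  have hS : IsCompact (C ∩ {x | 0 ≤ ψ x}) :=
    hC.inter_right (isClosed_le continuous_const hψ.continuous)
  have hSD : C ∩ {x | 0 ≤ ψ x} ⊆ D := fun x hx => h x hx.1 hx.2
  have hsupp : Function.support (D.indicator fun x => max (ψ x) 0) ⊆ C ∩ {x | 0 ≤ ψ x} := by
    intro x hx
    have hxD : x ∈ D := Set.mem_of_indicator_ne_zero hx
    rw [Function.mem_support, Set.indicator_of_mem hxD] at hx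
    refine ⟨hDC hxD, ?_⟩
    by_contra hneg
    exact hx (max_eq_right (not_le.1 hneg).le)
  have hts : tsupport (D.indicator fun x => max (ψ x) 0) ⊆ C ∩ {x | 0 ≤ ψ x} :=
    closure_minimal hsupp hS.isClosed
  refine ⟨exists_lipschitzWith_of_hasCompactSupport (fun x => ?_)
    (hS.of_isClosed_subset (isClosed_tsupport _) hts), hts.trans hSD⟩
  by_cases hx : x ∈ D
  · obtain ⟨K, t, ht, hK⟩ := hψ.max_const 0 x
    refine ⟨K, t ∩ D, inter_mem ht (hD.mem_nhds hx), fun y hy z hz => ?_⟩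
    rw [Set.indicator_of_mem hy.2, Set.indicator_of_mem hz.2]
    exact hK hy.1 hz.1
  · refine ⟨0, (C ∩ {x | 0 ≤ ψ x})ᶜ,
      hS.isClosed.isOpen_compl.mem_nhds fun hxS => hx (hSD hxS), fun y hy z hz => ?_⟩
    rw [Function.notMem_support.1 fun h' => hy (hsupp h'),
      Function.notMem_support.1 fun h' => hz (hsupp h')]
    simp

lemma isOpen_hBall {n : ℕ} (x₀ : Eucl n) (r : ℝ) : IsOpen (hBall x₀ r) :=
  isOpen_ball.inter (isOpen_lt continuous_const (contDiff_apply_last n).continuous)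

lemma BdrySolution.integral_inner_gradient_add_le_zero {n : ℕ} {F : Eucl n → ℝ → Eucl n → Eucl n}
    {F₀ : Eucl n → ℝ → Eucl n → ℝ} {g u U w : Eucl n → ℝ} {KU Kw : ℝ≥0}
    (hu : BdrySolution F F₀ g u) (hU : LipschitzWith KU U)
    (hUu : ∀ x : Eucl n, ‖x‖ ≤ 1 → 0 ≤ x (Fin.last n) → U x = u x)
    (hw : LipschitzWith Kw w) (hws : tsupport w ⊆ hBall 0 1) :
    ∫ x, (⟪F x (U x) (gradient U x), gradient w x⟫_ℝ +
          F₀ x (U x) (gradient U x) * w x) ≤ 0 := by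
  obtain ⟨⟨⟨Ku, hKu⟩, hg, hpos⟩, hvar⟩ := hu
  have hw0 : ∀ x, x ∉ hBall (0 : Eucl n) 1 → w x = 0 := fun x hx =>
    image_eq_zero_of_notMem_tsupport fun h => hx (hws h)
  have hadm : AdmissibleBdry g (fun x => u x - w x) := by
    refine ⟨⟨Ku + Kw, hKu.sub hw.lipschitzOnWith⟩, fun x hx hx0 => ?_, fun x hx => ?_⟩
    · show u x - w x = g x
      rw [hw0 x fun h => ?_, sub_zero, hg x hx hx0]
      exact absurd (mem_ball_zero_iff.1 h.1) (by rw [hx]; exact lt_irrefl _)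
    · show 0 ≤ u x - w x
      rw [hw0 x fun h => ?_, sub_zero]
      · exact hpos x hx
      · exact absurd hx.2 (ne_of_gt h.2)
  have h := hvar _ hadm
  have hcongr : ∀ᵐ x, x ∈ hBall (0 : Eucl n) 1 →
      ⟪F x (u x) (gradient u x), gradient (fun x => u x - w x) x - gradient u x⟫_ℝ +
        F₀ x (u x) (gradient u x) * ((u x - w x) - u x) =
      -(⟪F x (U x) (gradient U x), gradient w x⟫_ℝ + F₀ x (U x) (gradient U x) * w x) := by
    filter_upwards [hU.ae_differentiableAt, hw.ae_differentiableAt] with x hUx hwx hx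
    have hev : u =ᶠ[𝓝 x] U := by
      filter_upwards [(isOpen_hBall 0 1).mem_nhds hx] with y hy
      exact (hUu y (mem_ball_zero_iff.1 hy.1).le (le_of_lt hy.2)).symm
    have hgu : gradient u x = gradient U x := by rw [gradient, gradient, hev.fderiv_eq]
    have hgv : gradient (fun x => u x - w x) x = gradient U x - gradient w x := by
      have hev' : (fun x => u x - w x) =ᶠ[𝓝 x] fun x => U x - w x := by
        filter_upwards [hev] with y hy
        rw [hy]
      rw [gradient, hev'.fderiv_eq, fderiv_fun_sub hUx hwx, map_sub]
      rfl
    rw [hgv, hgu, hev.eq_of_nhds, sub_sub_cancel_left, inner_neg_right]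
    ring
  rw [setIntegral_congr_ae (isOpen_hBall 0 1).measurableSet hcongr,
    setIntegral_eq_integral_of_forall_compl_eq_zero, integral_neg] at h
  · linarith
  · intro x hx
    rw [hw0 x hx, gradient_eq_zero_of_notMem_tsupport fun h => hx (hws h)]
    simp

/-- A function `U ≤ a x_{n+1} + ε` whose normal derivative exceeds `m` wherever it is positive on
the thin ball can touch a translate of the barrier from below, at a positive height, only at
interior points of the half ball. -/
lemma sub_quadBarrier_lt_of_notMem_hBall {n : ℕ} {U : Eucl n → ℝ} {x₀ : Eucl n}
    {a m t s ε h : ℝ} (hx₀ : x₀ (Fin.last n) = 0) (ht : 0 ≤ t) (hts : t ≤ s) (hsm : s ≤ m - a)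
    (hε : 16 * ε < t) (hh : 0 < h)
    (hmax : ∀ x ∈ closedBall x₀ (1 / 4) ∩ {x : Eucl n | 0 ≤ x (Fin.last n)},
      U x - quadBarrier x₀ t s m 0 x ≤ h)
    (hUa : ∀ x ∈ closedBall x₀ (1 / 4) ∩ {x : Eucl n | 0 ≤ x (Fin.last n)},
      U x ≤ a * x (Fin.last n) + ε)
    (hUd : ∀ x ∈ tBall x₀ (1 / 4), 0 < U x → ∃ d : ℝ, m < d ∧
      Tendsto (fun r : ℝ => (U (x + r • eLast n) - U x) / r) (𝓝[>] (0 : ℝ)) (𝓝 d))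
    {x : Eucl n} (hx : x ∈ closedBall x₀ (1 / 4) ∩ {x : Eucl n | 0 ≤ x (Fin.last n)})
    (hxD : x ∉ hBall x₀ (1 / 4)) :
    U x - quadBarrier x₀ t s m 0 x < h := by
  by_contra! hcon
  have hxn : ‖x - x₀‖ ≤ 1 / 4 := by rw [← dist_eq_norm]; exact hx.1
  have hx0 : 0 ≤ x (Fin.last n) := hx.2
  rcases hxn.eq_or_lt with hxe | hxlt
  · have hy : x (Fin.last n) ≤ 1 / 4 := by
      have := abs_apply_last_le (x - x₀)
      rw [PiLp.sub_apply, hx₀, sub_zero] at this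
      exact (le_abs_self _).trans (this.trans hxn)
    have hUx := hUa x hx
    rw [quadBarrier, hxe] at hcon
    nlinarith [mul_nonneg hx0 (sub_nonneg.2 hy), mul_nonneg hx0 (sub_nonneg.2 hsm),
      mul_nonneg (mul_nonneg hx0 (sub_nonneg.2 hy)) (ht.trans hts)]
  · have hxz : x (Fin.last n) = 0 := by
      by_contra hne
      exact hxD ⟨by rwa [mem_ball, dist_eq_norm], lt_of_le_of_ne hx0 (Ne.symm hne)⟩
    have hxt : x ∈ tBall x₀ (1 / 4) := ⟨by rwa [mem_ball, dist_eq_norm], hxz⟩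
    have hUpos : 0 < U x := by
      rw [quadBarrier, hxz] at hcon
      have : 0 ≤ t * ‖x - x₀‖ ^ 2 := by positivity
      linarith
    obtain ⟨d, hd, hlim⟩ := hUd x hxt hUpos
    have hcont : Continuous fun r : ℝ => x + r • eLast n := by fun_prop
    have hev : ∀ᶠ r : ℝ in 𝓝[>] 0, x + r • eLast n ∈ ball x₀ (1 / 4) := by
      refine nhdsWithin_le_nhds (hcont.continuousAt.eventually_mem
        (isOpen_ball.mem_nhds ?_))
      simpa using hxt.1
    refine absurd (le_of_tendsto hlim (b := m) ?_) (not_le.2 hd)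
    filter_upwards [hev, self_mem_nhdsWithin] with r hr hr0
    have hr0' : (0 : ℝ) < r := hr0
    have hl : (x + r • eLast n) (Fin.last n) = r := by simp [eLast, hxz]
    have hm := hmax (x + r • eLast n) ⟨ball_subset_closedBall hr, by
      show 0 ≤ (x + r • eLast n) (Fin.last n)
      rw [hl]; exact hr0'.le⟩
    rw [quadBarrier_add_smul_eLast t s m 0 hx₀ hxz] at hm
    rw [div_le_iff₀ hr0']
    nlinarith [mul_nonneg (sub_nonneg.2 hts) (sq_nonneg r)]

end TOP
namespace TOP

/-- The upper bound on the open half ball extends to the thin ball by continuity. -/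
lemma le_mul_apply_last_add_of_hBall {n : ℕ} {U : Eucl n → ℝ} {a ε : ℝ} (hU : Continuous U)
    (h : ∀ x ∈ hBall (0 : Eucl n) 1, U x ≤ a * x (Fin.last n) + ε) {x : Eucl n}
    (hx : x ∈ ball (0 : Eucl n) 1) (hx0 : 0 ≤ x (Fin.last n)) :
    U x ≤ a * x (Fin.last n) + ε := by
  have hcont : Continuous fun r : ℝ => x + r • eLast n := by fun_prop
  have hl := (contDiff_apply_last n).continuous
  have hlim : ∀ f : Eucl n → ℝ, Continuous f →
      Tendsto (fun r : ℝ => f (x + r • eLast n)) (𝓝[>] 0) (𝓝 (f x)) := by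
    intro f hf
    have := ((hf.comp hcont).tendsto 0).mono_left (nhdsWithin_le_nhds (s := Set.Ioi 0))
    simpa [Function.comp_def] using this
  refine le_of_tendsto_of_tendsto (hlim U hU)
    (hlim (fun y => a * y (Fin.last n) + ε) (by fun_prop)) ?_
  have hev : ∀ᶠ r : ℝ in 𝓝[>] 0, x + r • eLast n ∈ ball (0 : Eucl n) 1 := by
    refine nhdsWithin_le_nhds (hcont.continuousAt.eventually_mem (isOpen_ball.mem_nhds ?_))
    simpa using hx
  filter_upwards [hev, self_mem_nhdsWithin] with r hr hr0
  refine h _ ⟨hr, ?_⟩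
  have hr0' : (0 : ℝ) < r := hr0
  show 0 < (x + r • eLast n) (Fin.last n)
  have : (x + r • eLast n) (Fin.last n) = x (Fin.last n) + r := by simp [eLast]
  rw [this]
  linarith

/-- The coincidence statement for parameters `t ≤ s` making the barrier a strict
supersolution. -/
lemma BdrySolution.eq_zero_of_mem_tBall {n : ℕ} {F : Eucl n → ℝ → Eucl n → Eucl n}
    {F₀ : Eucl n → ℝ → Eucl n → ℝ} {g u : Eucl n → ℝ} {lam L : ℝ → ℝ} {a m t s ε : ℝ}
    (ht : 0 < t) (hts : t ≤ s) (hs : s ≤ 1) (hsm : s ≤ m - a) (hε : 16 * ε < t)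
    (hc : t ≤ 2 * s * lam (|m| + 3) - 2 * t * (n + 1) * L (|m| + 3) - ε * L (|m| + 3))
    (h0 : H0 F F₀) (h1 : H1With lam F) (hr : Rescaled ε L F F₀) (hu : BdrySolution F F₀ g u)
    (hua : ∀ x ∈ hBall (0 : Eucl n) 1, u x ≤ a * x (Fin.last n) + ε)
    (hud : ∀ x ∈ tBall (0 : Eucl n) 1, u x ≠ 0 →
      ∃ d : ℝ, m < d ∧
        Tendsto (fun r : ℝ => (u (x + r • eLast n) - u x) / r) (𝓝[>] (0 : ℝ)) (𝓝 d))
    {x₀ : Eucl n} (hx₀ : x₀ ∈ tBall (0 : Eucl n) (1 / 2)) : u x₀ = 0 := by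
  by_contra hne
  have hx₀l : x₀ (Fin.last n) = 0 := hx₀.2
  have hx₀n : ‖x₀‖ < 1 / 2 := mem_ball_zero_iff.1 hx₀.1
  have hx₀t : x₀ ∈ tBall (0 : Eucl n) 1 := ⟨ball_subset_ball (by norm_num) hx₀.1, hx₀.2⟩
  have hux₀ : 0 < u x₀ := lt_of_le_of_ne (hu.1.2.2 x₀ hx₀t) (Ne.symm hne)
  obtain ⟨KU, hKu⟩ := hu.1.1
  obtain ⟨U, hU, hUeq⟩ := hKu.extend_real
  have hUu : ∀ x : Eucl n, ‖x‖ ≤ 1 → 0 ≤ x (Fin.last n) → U x = u x := fun x hx hx0 =>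
    (hUeq ⟨mem_closedBall_zero_iff.2 hx, hx0⟩).symm
  have hCB : closedBall x₀ (1 / 4) ⊆ ball (0 : Eucl n) 1 := by
    intro x hx
    rw [mem_closedBall, dist_eq_norm] at hx
    rw [mem_ball_zero_iff]
    have := norm_add_le (x - x₀) x₀
    rw [sub_add_cancel] at this
    linarith
  have hhB : hBall x₀ (1 / 4) ⊆ hBall 0 1 := fun x hx =>
    ⟨hCB (ball_subset_closedBall hx.1), hx.2⟩
  have hUa : ∀ x ∈ closedBall x₀ (1 / 4) ∩ {x : Eucl n | 0 ≤ x (Fin.last n)},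
      U x ≤ a * x (Fin.last n) + ε := fun x hx =>
    le_mul_apply_last_add_of_hBall hU.continuous
      (fun y hy => by
        rw [hUu y (mem_ball_zero_iff.1 hy.1).le (le_of_lt hy.2)]
        exact hua y hy) (hCB hx.1) hx.2
  have hUd : ∀ x ∈ tBall x₀ (1 / 4), 0 < U x → ∃ d : ℝ, m < d ∧
      Tendsto (fun r : ℝ => (U (x + r • eLast n) - U x) / r) (𝓝[>] (0 : ℝ)) (𝓝 d) := by
    intro x hx hUx
    have hxB := hCB (ball_subset_closedBall hx.1)
    have hx0 : x (Fin.last n) = 0 := hx.2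
    have hUx' := hUu x (mem_ball_zero_iff.1 hxB).le hx0.ge
    rw [hUx'] at hUx
    obtain ⟨d, hd, hlim⟩ := hud x ⟨hxB, hx0⟩ hUx.ne'
    refine ⟨d, hd, hlim.congr' ?_⟩
    have hcont : Continuous fun r : ℝ => x + r • eLast n := by fun_prop
    have hev : ∀ᶠ r : ℝ in 𝓝[>] 0, x + r • eLast n ∈ ball (0 : Eucl n) 1 := by
      refine nhdsWithin_le_nhds (hcont.continuousAt.eventually_mem (isOpen_ball.mem_nhds ?_))
      simpa using hxB
    filter_upwards [hev, self_mem_nhdsWithin] with r hr hr0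
    have hl : (x + r • eLast n) (Fin.last n) = r := by simp [eLast, hx0]
    rw [hUx', hUu _ (mem_ball_zero_iff.1 hr).le (hl.symm ▸ le_of_lt hr0)]
  set Dc : Set (Eucl n) := closedBall x₀ (1 / 4) ∩ {x : Eucl n | 0 ≤ x (Fin.last n)} with hDc
  have hDcc : IsCompact Dc := (isCompact_closedBall x₀ (1 / 4)).inter_right
    (isClosed_le continuous_const (contDiff_apply_last n).continuous)
  have hx₀Dc : x₀ ∈ Dc := ⟨mem_closedBall_self (by norm_num), hx₀l.ge⟩
  have hx₀D : x₀ ∉ hBall x₀ (1 / 4) := fun h => (ne_of_gt h.2) hx₀l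
  set f : Eucl n → ℝ := fun x => U x - quadBarrier x₀ t s m 0 x with hf
  have hfc : Continuous f := hU.continuous.sub (contDiff_quadBarrier x₀ t s m 0).continuous
  obtain ⟨xM, hxM, hmax⟩ := hDcc.exists_isMaxOn ⟨x₀, hx₀Dc⟩ hfc.continuousOn
  have hmax' : ∀ x ∈ Dc, f x ≤ f xM := fun x hx => hmax hx
  have hfx₀ : f x₀ = u x₀ := by
    rw [hf]
    simp [quadBarrier, hx₀l, hUu x₀ (by linarith) hx₀l.ge]
  have hpos : 0 < f xM := hux₀.trans_le (hfx₀ ▸ hmax' x₀ hx₀Dc)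
  have hle1 : f xM ≤ 1 := by
    have hy : 0 ≤ xM (Fin.last n) := hxM.2
    have hy1 : xM (Fin.last n) ≤ 1 := by
      have h2 := mem_ball_zero_iff.1 (hCB hxM.1)
      exact (le_abs_self _).trans ((abs_apply_last_le xM).trans h2.le)
    have hUx := hUa xM hxM
    have : 0 ≤ t * ‖xM - x₀‖ ^ 2 := by positivity
    show U xM - quadBarrier x₀ t s m 0 xM ≤ 1
    rw [quadBarrier]
    nlinarith [mul_nonneg hy (sub_nonneg.2 hsm),
      mul_nonneg (mul_nonneg hy (sub_nonneg.2 hy1)) (ht.le.trans hts)]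
  have hstrict : ∀ x ∈ Dc, x ∉ hBall x₀ (1 / 4) → f x < f xM := fun x hx hxD =>
    sub_quadBarrier_lt_of_notMem_hBall hx₀l ht.le hts hsm hε hpos hmax' hUa hUd hx hxD
  obtain ⟨x₁, hx₁, hmax₁⟩ := (hDcc.diff (isOpen_hBall x₀ (1 / 4))).exists_isMaxOn
    ⟨x₀, hx₀Dc, hx₀D⟩ hfc.continuousOn
  have h₁ : f x₁ < f xM := hstrict x₁ hx₁.1 hx₁.2
  have h₁0 : 0 < f x₁ := hux₀.trans_le (hfx₀ ▸ hmax₁ ⟨hx₀Dc, hx₀D⟩)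
  obtain ⟨δ, hδ, hgap⟩ := exists_gap_of_strict_supersolution h0 h1
    (isCompact_closedBall x₀ (1 / 4)) hCB hU (|m| + 3) ht
  obtain ⟨γ, hγ₁, hγM, hγδ⟩ : ∃ γ, f x₁ < γ ∧ γ < f xM ∧ f xM - δ ≤ γ :=
    ⟨max ((f x₁ + f xM) / 2) (f xM - δ), lt_max_of_lt_left (by linarith),
      max_lt (by linarith) (by linarith), le_max_right _ _⟩
  have hγ1 : |γ| ≤ 1 := by
    rw [abs_le]
    constructor <;> linarith
  have hψ : ∀ x, U x - quadBarrier x₀ t s m γ x = f x - γ := by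
    intro x
    simp only [hf, quadBarrier]
    ring
  have hψL : LocallyLipschitz fun x => U x - quadBarrier x₀ t s m γ x :=
    hU.locallyLipschitz.sub (contDiff_quadBarrier x₀ t s m γ).locallyLipschitz
  have hDDc : hBall x₀ (1 / 4) ⊆ Dc := fun x hx =>
    ⟨ball_subset_closedBall hx.1, (show 0 < x (Fin.last n) from hx.2).le⟩
  obtain ⟨⟨Kw, hw⟩, hws⟩ := exists_lipschitzWith_truncation hψL (isOpen_hBall x₀ (1 / 4)) hDcc
    hDDc (fun x hx hx0 => by
      by_contra hxD
      have : f x ≤ f x₁ := hmax₁ ⟨hx, hxD⟩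
      rw [hψ] at hx0
      linarith)
  set w : Eucl n → ℝ :=
    (hBall x₀ (1 / 4)).indicator fun x => max (U x - quadBarrier x₀ t s m γ x) 0 with hwdef
  have hx_of_mem : ∀ x ∈ closedBall x₀ (1 / 4), ‖x - x₀‖ ≤ 1 / 4 := fun x hx => by
    rw [← dist_eq_norm]; exact hx
  have hM : 0 < |m| + 3 := by positivity
  have hb := fun x (hx : x ∈ closedBall x₀ (1 / 4)) =>
    abs_quadBarrier_le (m := m) ht.le hts hs hx₀l (hx_of_mem x hx) hγ1
  have hbG : ∀ x ∈ closedBall x₀ (1 / 4), ‖quadBarrierGrad x₀ t s m x‖ ≤ |m| + 3 := fun x hx =>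
    norm_quadBarrierGrad_le ht.le hts hs hx₀l (hx_of_mem x hx)
  have hxMD : xM ∈ hBall x₀ (1 / 4) := by
    by_contra h
    exact lt_irrefl _ (hstrict xM hxM h)
  have hwM : w xM = f xM - γ := by
    rw [hwdef, Set.indicator_of_mem hxMD, hψ, max_eq_left (by linarith)]
  have hw0 : w xM = 0 := by
    refine hgap (quadBarrier x₀ t s m γ) (quadBarrierGrad x₀ t s m)
      (contDiff_quadBarrier x₀ t s m γ) (contDiff_quadBarrierGrad x₀ t s m)
      (hasGradientAt_quadBarrier x₀ t s m γ) hb hbG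
      (fun x hx => hc.trans (quadBarrier_strict_supersolution hM h0 h1 hr ht.le
        (ht.le.trans hts) (hCB hx) (hb x hx) (hbG x hx)))
      w Kw hw (hws.trans fun x hx => interior_maximal ball_subset_closedBall
        isOpen_ball hx.1) ?_ ?_ ?_
      (hu.integral_inner_gradient_add_le_zero hU hUu hw (hws.trans hhB)) xM
    · exact fun x => Set.indicator_nonneg (fun y _ => le_max_right _ _) x
    · intro x
      by_cases hx : x ∈ hBall x₀ (1 / 4)
      · rw [hwdef, Set.indicator_of_mem hx, hψ]
        have := hmax' x (hDDc hx)
        exact max_le (by linarith) hδ.le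
      · rw [hwdef, Set.indicator_of_notMem hx]
        exact hδ.le
    · intro x hx
      have hxD : x ∈ hBall x₀ (1 / 4) := Set.mem_of_indicator_ne_zero hx
      rw [hwdef, Set.indicator_of_mem hxD] at hx ⊢
      refine max_eq_left (le_of_lt ?_)
      by_contra h
      exact hx (max_eq_right (not_lt.1 h))
  linarith

end TOP

open TOP in
/-- Lemma: coincidence for the boundary obstacle problem. For
`a < m` there is `ε > 0`, depending only on `n, a, m` and the functions `λ(·)`, `L(·)`,
such that any Lipschitz solution of the Signorini problem with `ε`-rescaled operator,
lying below `a x_{n+1} + ε` on `B₁⁺` and with one-sided normal derivative `> m` at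
every point of `B₁' ∖ Λ(u)`, vanishes on `B'_{1/2}`. -/
theorem boundary_obstacle_coincidence (n : ℕ) (a m : ℝ) (ham : a < m) (lam L : ℝ → ℝ) :
    ∃ ε : ℝ, 0 < ε ∧
      ∀ (F : Eucl n → ℝ → Eucl n → Eucl n) (F₀ : Eucl n → ℝ → Eucl n → ℝ)
        (g u : Eucl n → ℝ),
        H0 F F₀ → H1With lam F → Rescaled ε L F F₀ →
        BdrySolution F F₀ g u →
        (∀ x ∈ hBall (0 : Eucl n) 1, u x ≤ a * x (Fin.last n) + ε) →
        (∀ x ∈ tBall (0 : Eucl n) 1, u x ≠ 0 →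
          ∃ d : ℝ, m < d ∧
            Filter.Tendsto (fun t : ℝ => (u (x + t • eLast n) - u x) / t)
              (𝓝[>] (0 : ℝ)) (nhds d)) →
        ∀ x ∈ tBall (0 : Eucl n) (1 / 2), u x = 0 := by
  by_cases hl : lam (|m| + 3) ≤ 0
  · exact ⟨1, one_pos, fun F F₀ g u _ h1 => absurd (h1 (|m| + 3) (by positivity)).1 hl.not_gt⟩
  rw [not_le] at hl
  obtain ⟨κ, hκ1, hκ⟩ : ∃ κ : ℝ, 1 ≤ κ ∧
      (n + 1) * |L (|m| + 3)| + 1 ≤ κ * lam (|m| + 3) :=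
    ⟨max 1 (((n + 1) * |L (|m| + 3)| + 1) / lam (|m| + 3)), le_max_left _ _,
      (div_le_iff₀ hl).1 (le_max_right _ _)⟩
  have hs : 0 < min 1 (m - a) := lt_min one_pos (sub_pos.2 ham)
  have hκ0 : 0 < κ := one_pos.trans_le hκ1
  obtain ⟨t, ht, hst⟩ : ∃ t : ℝ, 0 < t ∧ t * κ = min 1 (m - a) :=
    ⟨min 1 (m - a) / κ, div_pos hs hκ0, div_mul_cancel₀ _ hκ0.ne'⟩
  have hts : t ≤ min 1 (m - a) := hst ▸ le_mul_of_one_le_right ht.le hκ1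
  have ht1 : t ≤ 1 := hts.trans (min_le_left _ _)
  have hL : 0 < 32 * (1 + |L (|m| + 3)|) := by positivity
  obtain ⟨ε, hε, hεt⟩ : ∃ ε : ℝ, 0 < ε ∧ ε * (32 * (1 + |L (|m| + 3)|)) = t :=
    ⟨t / (32 * (1 + |L (|m| + 3)|)), div_pos ht hL, div_mul_cancel₀ _ hL.ne'⟩
  have hεL : 0 ≤ ε * |L (|m| + 3)| := by positivity
  refine ⟨ε, hε, fun F F₀ g u h0 h1 hr hu hua hud x hx =>
    hu.eq_zero_of_mem_tBall ht hts (min_le_left _ _) (min_le_right _ _) (by linarith)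
      ?_ h0 h1 hr hua hud hx⟩
  have hLabs := le_abs_self (L (|m| + 3))
  have e1 : t * ((n + 1) * L (|m| + 3)) ≤ t * ((n + 1) * |L (|m| + 3)|) := by gcongr
  have e2 : ε * L (|m| + 3) ≤ ε * |L (|m| + 3)| := by gcongr
  have e3 := mul_le_mul_of_nonneg_left hκ ht.le
  rw [← hst]
  linarith
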